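/- The weight-5 multiple zeta values satisfy 2ζ(1,4) + ζ(2,3) + ζ(3,2) + ζ(1,2,2) + ζ(2,1,2) − 2ζ(1,1,1,2) = 0. -/

import Mathlib

/-- Multiple zeta value `ζ(k₁,…,k_r) = Σ_{0<m₁<⋯<m_r} ∏ mᵢ^{-kᵢ}`. -/
noncomputable def mzv (k : List ℕ) : ℝ :=
  ∑' m : {f : Fin k.length → ℕ+ // StrictMono f},
    ∏ i : Fin k.length, ((m.1 i : ℝ) ^ (k.get i))⁻¹

open scoped ENNReal
open Filter Topology

namespace MZVAux

/-- recursive nested sum over indices larger than `m`. -/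
noncomputable def Z : List ℕ → ℕ → ℝ≥0∞
  | [], _ => 1
  | a :: k, m => ∑' j : ℕ, (((m + 1 + j : ℕ) : ℝ≥0∞)⁻¹) ^ a * Z k (m + 1 + j)

/-- index type of tuples above `m`. -/
abbrev Idx (r m : ℕ) := {f : Fin r → ℕ+ // StrictMono f ∧ ∀ i, m < (f i : ℕ)}

noncomputable def S (k : List ℕ) (m : ℕ) : ℝ≥0∞ :=
  ∑' f : Idx k.length m, ∏ i : Fin k.length, (((f.1 i : ℕ) : ℝ≥0∞)⁻¹) ^ (k.get i)

lemma sigma_ext' {r m : ℕ} {p q : Σ j : ℕ, Idx r (m + 1 + j)} (h1 : p.1 = q.1)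
    (h2 : p.2.1 = q.2.1) : p = q := by
  obtain ⟨j, f⟩ := p
  obtain ⟨i, g⟩ := q
  obtain rfl : j = i := h1
  obtain rfl : f = g := Subtype.ext h2
  rfl

def splitEquiv (r m : ℕ) : (Σ j : ℕ, Idx r (m + 1 + j)) ≃ Idx (r + 1) m where
  toFun p := ⟨Fin.cons ⟨m + 1 + p.1, by omega⟩ p.2.1, by
    obtain ⟨j, f, hf, hm⟩ := p
    constructor
    · rw [Fin.strictMono_iff_lt_succ]
      intro i
      cases r with
      | zero => exact i.elim0
      | succ r =>
        refine Fin.cases ?_ (fun i => ?_) i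
        · show _ < f 0
          have := hm 0
          rw [← PNat.coe_lt_coe]
          exact this
        · show f i.castSucc < f i.succ
          exact hf (Fin.castSucc_lt_succ)
    · intro i
      refine Fin.cases ?_ (fun i => ?_) i
      · show m < m + 1 + j
        omega
      · show m < f i
        have := hm i
        omega⟩
  invFun f := ⟨(f.1 0 : ℕ) - (m + 1), ⟨fun i => f.1 i.succ, by
    obtain ⟨f, hf, hm⟩ := f
    constructor
    · intro i j h
      exact hf (Fin.succ_lt_succ_iff.mpr h)
    · intro i
      have h0 := hm 0
      have : f 0 < f i.succ := hf (Fin.succ_pos i)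
      rw [← PNat.coe_lt_coe] at this
      show m + 1 + ((f 0 : ℕ) - (m + 1)) < f i.succ
      omega⟩⟩
  left_inv p := by
    obtain ⟨j, f, hf, hm⟩ := p
    refine sigma_ext' ?_ ?_
    · show m + 1 + j - (m + 1) = j
      omega
    · rfl
  right_inv f := by
    obtain ⟨f, hf, hm⟩ := f
    apply Subtype.ext
    funext i
    refine Fin.cases ?_ (fun i => ?_) i
    · apply PNat.eq
      have := hm 0
      show m + 1 + ((f 0 : ℕ) - (m + 1)) = f 0
      omega
    · rfl

lemma S_eq_Z (k : List ℕ) : ∀ m, S k m = Z k m := by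
  induction k with
  | nil =>
    intro m
    unfold S Z
    have : Unique (Idx ([] : List ℕ).length m) :=
      { default := ⟨fun i => i.elim0, fun i => i.elim0, fun i => i.elim0⟩
        uniq := fun f => Subtype.ext (funext fun i => i.elim0) }
    rw [tsum_eq_single (default : Idx ([] : List ℕ).length m)
      (fun b hb => absurd (this.eq_default b |>.trans (this.eq_default _).symm) hb)]
    simp
  | cons a k ih =>
    intro m
    unfold S Z
    show ∑' f : Idx (k.length + 1) m, ∏ i : Fin (k.length + 1),
      (((f.1 i : ℕ) : ℝ≥0∞)⁻¹) ^ ((a :: k).get i) = _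
    rw [← (splitEquiv k.length m).tsum_eq, ENNReal.tsum_sigma']
    refine tsum_congr fun j => ?_
    rw [← ih, S, ← ENNReal.tsum_mul_left]
    refine tsum_congr fun f => ?_
    show ∏ i : Fin (k.length + 1), _ = _
    rw [Fin.prod_univ_succ]
    rfl

lemma mzv_eq (k : List ℕ) : mzv k = (Z k 0).toReal := by
  rw [← S_eq_Z, S, ENNReal.tsum_toReal_eq]
  · unfold mzv
    let e : Idx k.length 0 ≃ {f : Fin k.length → ℕ+ // StrictMono f} :=
      Equiv.subtypeEquivRight (fun f => ⟨fun h => h.1, fun h => ⟨h, fun i => (f i).pos⟩⟩)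
    rw [← e.tsum_eq]
    refine tsum_congr fun f => ?_
    rw [ENNReal.toReal_prod]
    refine Finset.prod_congr rfl fun i _ => ?_
    simp [e]
  · intro f
    refine ENNReal.prod_ne_top fun i _ => ?_
    refine ENNReal.pow_ne_top ?_
    simp

lemma tele (f g : ℕ → ℝ≥0∞) (h : ∀ j, g j = f j + g (j + 1)) (h0 : Tendsto g atTop (𝓝 0)) :
    ∑' j, f j = g 0 := by
  have h1 : ∀ N, ∑ j ∈ Finset.range N, f j + g N = g 0 := by
    intro N
    induction N with
    | zero => simp
    | succ N ih => rw [Finset.sum_range_succ, add_assoc, ← h, ih]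
  have h2 := (ENNReal.summable (f := f)).hasSum.tendsto_sum_nat.add h0
  simp only [h1, add_zero] at h2
  exact (tendsto_nhds_unique h2 tendsto_const_nhds)

/-- the two operators; `true` is `y`, `false` is `x`. -/
noncomputable def op : Bool → (ℕ → ℝ≥0∞) → ℕ → ℝ≥0∞
  | true, g, m => ∑' j : ℕ, ((m + 1 + j : ℕ) : ℝ≥0∞)⁻¹ * g (m + 1 + j)
  | false, g, m => (m : ℝ≥0∞)⁻¹ * g m

noncomputable def E : List Bool → (ℕ → ℝ≥0∞) → ℕ → ℝ≥0∞
  | [], g => g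
  | b :: W, g => op b (E W g)

lemma op_comm (b c : Bool) (F : ℕ → ℕ → ℝ≥0∞) (m n : ℕ) :
    op b (fun m' => op c (fun n' => F m' n') n) m =
      op c (fun n' => op b (fun m' => F m' n') m) n := by
  cases b <;> cases c <;> simp only [op, ← ENNReal.tsum_mul_left]
  · ring
  · exact tsum_congr fun j => by ring
  · exact tsum_congr fun j => by ring
  · rw [ENNReal.tsum_comm]
    exact tsum_congr fun j => tsum_congr fun i => by ring

lemma E_comm (b : Bool) (W : List Bool) : ∀ (F : ℕ → ℕ → ℝ≥0∞) (m n : ℕ),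
    op b (fun m' => E W (fun n' => F m' n') n) m =
      E W (fun n' => op b (fun m' => F m' n') m) n := by
  induction W with
  | nil => intro F m n; rfl
  | cons c W ih =>
    intro F m n
    simp only [E]
    rw [op_comm b c (fun m' n' => E W (fun n'' => F m' n'') n')]
    congr 1
    funext n'
    exact ih F m n'

lemma E_append (W : List Bool) (b : Bool) (g : ℕ → ℝ≥0∞) :
    E (W ++ [b]) g = E W (op b g) := by
  induction W with
  | nil => rfl
  | cons c W ih => simp only [List.cons_append, E, ih]

noncomputable def CR (m n : ℕ) : ℝ := (m.factorial * n.factorial : ℝ) / (m + n).factorial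

noncomputable def C (m n : ℕ) : ℝ≥0∞ := ENNReal.ofReal (CR m n)

lemma C_symm (m n : ℕ) : C m n = C n m := by
  unfold C CR
  rw [mul_comm, add_comm m n]

lemma C_zero (m : ℕ) : C m 0 = 1 := by
  unfold C CR
  have : (m.factorial : ℝ) ≠ 0 := by positivity
  simp [this]

lemma CR_pos (m n : ℕ) : 0 < CR m n := by unfold CR; positivity

lemma CR_step (a n : ℕ) (hn : 0 < n) :
    (n : ℝ)⁻¹ * CR a n = ((a + 1 : ℕ) : ℝ)⁻¹ * CR (a + 1) n + (n : ℝ)⁻¹ * CR (a + 1) n := by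
  unfold CR
  have h : a + 1 + n = (a + n) + 1 := by ring
  rw [h, Nat.factorial_succ, Nat.factorial_succ]
  have : ((a + n).factorial : ℝ) ≠ 0 := by positivity
  have hn' : (n : ℝ) ≠ 0 := by positivity
  have h3 : (a : ℝ) + 1 ≠ 0 := by positivity
  have h4 : (a : ℝ) + n + 1 ≠ 0 := by positivity
  push_cast
  field_simp
  ring

lemma inv_nat (n : ℕ) (hn : 0 < n) : (n : ℝ≥0∞)⁻¹ = ENNReal.ofReal ((n : ℝ)⁻¹) := by
  rw [ENNReal.ofReal_inv_of_pos (by positivity), ENNReal.ofReal_natCast]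

lemma C_step (a n : ℕ) (hn : 0 < n) :
    (n : ℝ≥0∞)⁻¹ * C a n = ((a + 1 : ℕ) : ℝ≥0∞)⁻¹ * C (a + 1) n + (n : ℝ≥0∞)⁻¹ * C (a + 1) n := by
  have p1 := CR_pos a n
  have p2 := CR_pos (a + 1) n
  unfold C
  rw [inv_nat n hn, inv_nat (a + 1) (by omega), ← ENNReal.ofReal_mul (by positivity),
    ← ENNReal.ofReal_mul (by positivity), ← ENNReal.ofReal_mul (by positivity),
    ← ENNReal.ofReal_add (by positivity) (by positivity), CR_step a n hn]

lemma CR_le (m n : ℕ) (hn : 0 < n) : CR m n ≤ n.factorial * (1 / ((m : ℝ) + 1)) := by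
  unfold CR
  have h : (m + 1).factorial ≤ (m + n).factorial := Nat.factorial_le (by omega)
  have h' : ((m + 1 : ℝ) * m.factorial) ≤ (m + n).factorial := by
    rw [Nat.factorial_succ] at h
    exact_mod_cast h
  rw [mul_one_div, div_le_div_iff₀ (by positivity) (by positivity)]
  have : (0 : ℝ) < n.factorial := by positivity
  nlinarith

lemma C_tendsto (m n : ℕ) (hn : 0 < n) :
    Tendsto (fun j => (n : ℝ≥0∞)⁻¹ * C (m + j) n) atTop (𝓝 0) := by
  have h1 : Tendsto (fun j => CR j n) atTop (𝓝 0) := by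
    refine squeeze_zero (fun j => (CR_pos j n).le) (fun j => CR_le j n hn) ?_
    simpa using (tendsto_one_div_add_atTop_nhds_zero_nat (𝕜 := ℝ)).const_mul (n.factorial : ℝ)
  have h2 : Tendsto (fun j => C j n) atTop (𝓝 0) := by
    simpa [C] using ENNReal.tendsto_ofReal h1
  have h3 : Tendsto (fun j => C (m + j) n) atTop (𝓝 0) := by
    simpa [add_comm] using (tendsto_add_atTop_iff_nat m).2 h2
  have h4 := ENNReal.Tendsto.const_mul (a := (n : ℝ≥0∞)⁻¹) h3
    (Or.inr (by simp; omega))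
  simpa using h4

lemma harm (m : ℕ) : ∑' j : ℕ, ((m + 1 + j : ℕ) : ℝ≥0∞)⁻¹ = ⊤ := by
  by_contra h
  have h1 := ENNReal.summable_toReal h
  have h2 : Summable fun j : ℕ => ((j + (m + 1) : ℕ) : ℝ)⁻¹ := by
    refine h1.congr fun j => ?_
    rw [ENNReal.toReal_inv, ENNReal.toReal_natCast, add_comm]
  exact Real.not_summable_natCast_inv
    ((summable_nat_add_iff (f := fun n : ℕ => (n : ℝ)⁻¹) (m + 1)).1 h2)

lemma transport_y (m n : ℕ) : op true (fun m' => C m' n) m = op false (fun n' => C m n') n := by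
  simp only [op]
  rcases Nat.eq_zero_or_pos n with rfl | hn
  · simp only [C_zero, mul_one]
    rw [harm]
    simp
  · rw [tele _ (fun j => (n : ℝ≥0∞)⁻¹ * C (m + j) n) ?_ (C_tendsto m n hn)]
    · rfl
    · intro j
      have := C_step (m + j) n hn
      have e : m + 1 + j = m + j + 1 := by ring
      rw [e]
      exact this

lemma transport (b : Bool) (m n : ℕ) :
    op b (fun m' => C m' n) m = op (!b) (fun n' => C m n') n := by
  cases b
  · have := transport_y n m
    simp only [C_symm _ m, C_symm n _] at this
    exact this.symm
  · exact transport_y m n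

def dual (W : List Bool) : List Bool := (W.map (!·)).reverse

lemma duality_aux (W : List Bool) : ∀ m n,
    E W (fun m' => C m' n) m = E (dual W) (fun n' => C m n') n := by
  induction W with
  | nil => intro m n; rfl
  | cons b W ih =>
    intro m n
    have hd : dual (b :: W) = dual W ++ [!b] := by simp [dual]
    rw [hd, E_append]
    simp only [E]
    have : E W (fun m' => C m' n) = fun m' => E (dual W) (fun n' => C m' n') n :=
      funext fun m' => ih m' n
    rw [this, E_comm]
    congr 1
    funext n'
    exact transport b m n'

lemma duality (W : List Bool) : E W (fun _ => 1) 0 = E (dual W) (fun _ => 1) 0 := by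
  have := duality_aux W 0 0
  simpa only [C_zero, C_symm 0] using this

def word : List ℕ → List Bool
  | [] => []
  | a :: k => true :: (List.replicate (a - 1) false ++ word k)

lemma E_rep (a : ℕ) (W : List Bool) (g : ℕ → ℝ≥0∞) (m : ℕ) :
    E (List.replicate a false ++ W) g m = ((m : ℝ≥0∞)⁻¹) ^ a * E W g m := by
  induction a with
  | zero => simp
  | succ a ih =>
    simp only [List.replicate_succ, List.cons_append, E, op, ih]
    ring

lemma Z_eq_E (k : List ℕ) (hk : ∀ a ∈ k, 0 < a) :
    ∀ m, Z k m = E (word k) (fun _ => 1) m := by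
  induction k with
  | nil => intro m; rfl
  | cons a k ih =>
    intro m
    simp only [Z, word, E, op, E_rep]
    refine tsum_congr fun j => ?_
    rw [ih (fun b hb => hk b (List.mem_cons_of_mem _ hb)), ← mul_assoc]
    obtain ⟨c, rfl⟩ : ∃ c, a = c + 1 := ⟨a - 1, by have := hk a (by simp); omega⟩
    simp [pow_succ']

lemma Z_dual (k l : List ℕ) (hk : ∀ a ∈ k, 0 < a) (hl : ∀ a ∈ l, 0 < a)
    (h : dual (word k) = word l) : Z k 0 = Z l 0 := by
  rw [Z_eq_E k hk, Z_eq_E l hl, duality, h]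

lemma d1 : Z [1,1,1,2] 0 = Z [5] 0 := Z_dual _ _ (by simp) (by simp) (by decide)
lemma d2 : Z [1,2,2] 0 = Z [2,3] 0 := Z_dual _ _ (by simp) (by simp) (by decide)
lemma d3 : Z [2,1,2] 0 = Z [3,2] 0 := Z_dual _ _ (by simp) (by simp) (by decide)

/-! Sum formula -/

noncomputable def iv (n : ℕ) : ℝ≥0∞ := (n : ℝ≥0∞)⁻¹

lemma Z_two (a b : ℕ) : Z [a, b] 0 =
    ∑' i : ℕ, ∑' j : ℕ, iv (i + 1) ^ a * iv (i + j + 2) ^ b := by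
  simp only [Z, mul_one, ← ENNReal.tsum_mul_left]
  refine tsum_congr fun i => tsum_congr fun j => ?_
  have h1 : 0 + 1 + i = i + 1 := by ring
  have h2 : i + 1 + 1 + j = i + j + 2 := by ring
  rw [h1, h2]; rfl

lemma Z_five : Z [5] 0 = ∑' i : ℕ, iv (i + 1) ^ 5 := by
  simp only [Z, mul_one]
  refine tsum_congr fun i => ?_
  have h1 : 0 + 1 + i = i + 1 := by ring
  rw [h1]; rfl

lemma iv_ofReal (n : ℕ) : iv (n + 1) = ENNReal.ofReal (((n : ℝ) + 1)⁻¹) := by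
  rw [iv, inv_nat _ (by omega)]; push_cast; rfl

lemma key (i j : ℕ) :
    (iv (i + 1) ^ 1 * iv (i + j + 2) ^ 4 + iv (i + 1) ^ 2 * iv (i + j + 2) ^ 3
      + iv (i + 1) ^ 3 * iv (i + j + 2) ^ 2) + iv (j + 1) ^ 1 * iv (i + j + 2) ^ 4
      = iv (i + 1) ^ 3 * (iv (j + 1) * iv (i + j + 2)) := by
  have e : i + j + 2 = (i + j + 1) + 1 := by ring
  rw [e, iv_ofReal, iv_ofReal, iv_ofReal]
  have p1 : (0 : ℝ) < ((i : ℝ) + 1)⁻¹ := by positivity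
  have p2 : (0 : ℝ) < ((j : ℝ) + 1)⁻¹ := by positivity
  have p3 : (0 : ℝ) < (((i + j + 1 : ℕ) : ℝ) + 1)⁻¹ := by positivity
  simp only [← ENNReal.ofReal_pow p1.le, ← ENNReal.ofReal_pow p2.le, ← ENNReal.ofReal_pow p3.le]
  repeat rw [← ENNReal.ofReal_mul (by positivity)]
  repeat rw [← ENNReal.ofReal_add (by positivity) (by positivity)]
  congr 1
  push_cast
  have h1 : (i : ℝ) + 1 ≠ 0 := by positivity
  have h2 : (j : ℝ) + 1 ≠ 0 := by positivity
  have h3 : (i : ℝ) + j + 1 + 1 ≠ 0 := by positivity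
  field_simp
  ring

lemma iv_tendsto (a : ℕ) : Tendsto (fun j => iv (j + a)) atTop (𝓝 0) :=
  (tendsto_add_atTop_iff_nat a).2 ENNReal.tendsto_inv_nat_nhds_zero

lemma tele_step (i j : ℕ) :
    iv (j + 1) = ((i + 1 : ℕ) : ℝ≥0∞) * (iv (j + 1) * iv (i + j + 2)) + iv (i + j + 2) := by
  have e : i + j + 2 = (i + j + 1) + 1 := by ring
  rw [e, iv_ofReal, iv_ofReal, ← ENNReal.ofReal_natCast]
  have p2 : (0 : ℝ) < ((j : ℝ) + 1)⁻¹ := by positivity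
  have p3 : (0 : ℝ) < (((i + j + 1 : ℕ) : ℝ) + 1)⁻¹ := by positivity
  repeat rw [← ENNReal.ofReal_mul (by positivity)]
  repeat rw [← ENNReal.ofReal_add (by positivity) (by positivity)]
  congr 1
  push_cast
  have h2 : (j : ℝ) + 1 ≠ 0 := by positivity
  have h3 : (i : ℝ) + j + 1 + 1 ≠ 0 := by positivity
  field_simp
  ring

lemma iv_ne_top (n : ℕ) : iv (n + 1) ≠ ⊤ := by simp [iv]

lemma inner (i : ℕ) : ∑' j : ℕ, ((i + 1 : ℕ) : ℝ≥0∞) * (iv (j + 1) * iv (i + j + 2)) =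
    ∑ t ∈ Finset.range (i + 1), iv (t + 1) := by
  rw [tele _ (fun j => ∑ t ∈ Finset.range (i + 1), iv (j + (t + 1)))]
  · simp
  · intro j
    have h1 : ∑ t ∈ Finset.range (i + 1), iv (j + (t + 1)) =
        ∑ t ∈ Finset.range i, iv (j + 1 + (t + 1)) + iv (j + 1) := by
      rw [Finset.sum_range_succ']
      simp [add_comm, add_left_comm]
    rw [h1, Finset.sum_range_succ]
    have e : j + 1 + (i + 1) = i + j + 2 := by ring
    rw [e]
    conv_lhs => rw [tele_step i j]
    ring
  · have := tendsto_finsetSum (Finset.range (i + 1)) (fun t _ => iv_tendsto (t + 1))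
    simpa using this

lemma inner' (i : ℕ) : ∑' j : ℕ, iv (j + 1) * iv (i + j + 2) =
    iv (i + 1) * ∑ t ∈ Finset.range (i + 1), iv (t + 1) := by
  rw [← inner, ENNReal.tsum_mul_left, ← mul_assoc, iv, ENNReal.inv_mul_cancel (by simp) (by simp),
    one_mul]

lemma swap (f : ℕ → ℕ → ℝ≥0∞) :
    ∑' i : ℕ, ∑' j : ℕ, f i (i + j + 1) = ∑' n : ℕ, ∑ i ∈ Finset.range n, f i n := by
  have h1 : ∀ i, ∑' j : ℕ, f i (i + j + 1) = ∑' n : ℕ, if i < n then f i n else 0 := by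
    intro i
    have h0 := Summable.sum_add_tsum_nat_add' (f := fun n => if i < n then f i n else 0)
      (k := i + 1) ENNReal.summable
    rw [← h0, Finset.sum_eq_zero, zero_add]
    · refine tsum_congr fun j => ?_
      have e : j + (i + 1) = i + j + 1 := by ring
      rw [e, if_pos (by omega)]
    · intro x hx
      rw [if_neg]
      have := Finset.mem_range.1 hx
      omega
  simp only [h1]
  rw [ENNReal.tsum_comm]
  refine tsum_congr fun n => ?_
  rw [tsum_eq_sum (s := Finset.range n)]
  · refine Finset.sum_congr rfl fun i hi => ?_
    rw [if_pos (Finset.mem_range.1 hi)]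
  · intro i hi
    rw [if_neg (by simpa using hi)]

lemma Z14 : Z [1, 4] 0 = ∑' n : ℕ, iv (n + 1) ^ 4 * ∑ t ∈ Finset.range n, iv (t + 1) := by
  rw [Z_two]
  have := swap (fun i n => iv (i + 1) ^ 1 * iv (n + 1) ^ 4)
  simp only [pow_one, ← Finset.sum_mul] at this ⊢
  simp only [mul_comm (iv _ ^ 4)]
  exact this

lemma zfin (k : ℕ) (hk : 1 < k) : ∑' n : ℕ, iv (n + 1) ^ k ≠ ⊤ := by
  have h := (summable_nat_add_iff (f := fun n : ℕ => ((n : ℝ) ^ k)⁻¹) 1).2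
    (Real.summable_nat_pow_inv.2 hk)
  have h2 : ∀ n : ℕ, iv (n + 1) ^ k = ENNReal.ofReal (((n + 1 : ℕ) : ℝ) ^ k)⁻¹ := by
    intro n
    rw [iv_ofReal, ← ENNReal.ofReal_pow (by positivity), inv_pow]
    push_cast; rfl
  simp only [h2]
  exact h.tsum_ofReal_ne_top

lemma Z14_fin : Z [1, 4] 0 ≠ ⊤ := by
  rw [Z14]
  refine ne_top_of_le_ne_top (zfin 3 (by norm_num)) (ENNReal.tsum_le_tsum fun n => ?_)
  have h : ∑ t ∈ Finset.range n, iv (t + 1) ≤ ((n + 1 : ℕ) : ℝ≥0∞) := by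
    calc ∑ t ∈ Finset.range n, iv (t + 1) ≤ ∑ t ∈ Finset.range n, 1 := by
          refine Finset.sum_le_sum fun t _ => ?_
          simp [iv]
      _ ≤ _ := by simp
  calc iv (n + 1) ^ 4 * ∑ t ∈ Finset.range n, iv (t + 1)
      ≤ iv (n + 1) ^ 4 * ((n + 1 : ℕ) : ℝ≥0∞) := by gcongr
    _ = iv (n + 1) ^ 3 * (iv (n + 1) * ((n + 1 : ℕ) : ℝ≥0∞)) := by ring
    _ = iv (n + 1) ^ 3 := by
      rw [iv, ENNReal.inv_mul_cancel (by simp) (by simp), mul_one]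

lemma sum_formula : Z [1, 4] 0 + Z [2, 3] 0 + Z [3, 2] 0 = Z [5] 0 := by
  have hswap : Z [1, 4] 0 = ∑' i : ℕ, ∑' j : ℕ, iv (j + 1) ^ 1 * iv (i + j + 2) ^ 4 := by
    rw [Z_two, ENNReal.tsum_comm]
    simp only [add_comm]
  have h : (Z [1, 4] 0 + Z [2, 3] 0 + Z [3, 2] 0) + Z [1, 4] 0 = Z [5] 0 + Z [1, 4] 0 := by
    calc (Z [1, 4] 0 + Z [2, 3] 0 + Z [3, 2] 0) + Z [1, 4] 0
        = ∑' i : ℕ, ∑' j : ℕ, iv (i + 1) ^ 3 * (iv (j + 1) * iv (i + j + 2)) := by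
          simp only [← key, ENNReal.tsum_add]
          rw [← hswap, ← Z_two, ← Z_two, ← Z_two]
      _ = ∑' i : ℕ, iv (i + 1) ^ 4 * ∑ t ∈ Finset.range (i + 1), iv (t + 1) := by
          refine tsum_congr fun i => ?_
          rw [ENNReal.tsum_mul_left, inner']
          ring
      _ = Z [5] 0 + Z [1, 4] 0 := by
          rw [Z_five, Z14, ← ENNReal.tsum_add]
          refine tsum_congr fun i => ?_
          rw [Finset.sum_range_succ]
          ring
  exact (ENNReal.add_left_inj Z14_fin).1 h

end MZVAux

open MZVAux in
theorem mzv_rel_14 :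
    2 * mzv [1,4] + mzv [2,3] + mzv [3,2] + mzv [1,2,2] + mzv [2,1,2] -
      2 * mzv [1,1,1,2] = 0 := by
  simp only [mzv_eq, d1, d2, d3]
  have h5 : Z [5] 0 ≠ ⊤ := by rw [Z_five]; exact zfin 5 (by norm_num)
  have hs := sum_formula
  have hfin : Z [1, 4] 0 + Z [2, 3] 0 + Z [3, 2] 0 ≠ ⊤ := by rw [hs]; exact h5
  have h12 := (ENNReal.add_ne_top.1 hfin).1
  have h3 := (ENNReal.add_ne_top.1 hfin).2
  have h1 := (ENNReal.add_ne_top.1 h12).1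
  have h2 := (ENNReal.add_ne_top.1 h12).2
  rw [← hs, ENNReal.toReal_add h12 h3, ENNReal.toReal_add h1 h2]
  ring
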